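/- Let k ≥ 1 and s ≥ 1 be integers. A monomial x of degree 2^s − 1 in P_k whose weight vector satisfies ω(x) ≤ (1, 1, …, 1) (s ones followed by zeros) in the left lexicographic order is admissible if and only if x = x_{i_1} · x_{i_2}^2 · x_{i_3}^4 ⋯ x_{i_{m−1}}^{2^{m−2}} · x_{i_m}^{2^s − 2^{m−1}} for some integer m with 1 ≤ m ≤ min{s, k} and some indices 1 ≤ i_1 < i_2 < … < i_m ≤ k. -/

import Mathlib

open MvPolynomial

/-- The total Steenrod square on `P_k = F_2[x_1,…,x_k]`, the algebra map with
`Sq(x_j) = x_j + x_j^2`. -/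
noncomputable def SqTotal (k : ℕ) :
    MvPolynomial (Fin k) (ZMod 2) →ₐ[ZMod 2] MvPolynomial (Fin k) (ZMod 2) :=
  aeval fun j => X j + X j ^ 2

/-- The Steenrod square `Sq^i : P_k → P_k`, sending a homogeneous polynomial `f` of
degree `d` to the degree-`d + i` homogeneous component of `Sq(f)`, extended additively. -/
noncomputable def SqOp (k i : ℕ) (f : MvPolynomial (Fin k) (ZMod 2)) :
    MvPolynomial (Fin k) (ZMod 2) :=
  ∑ d ∈ Finset.range (f.totalDegree + 1),
    homogeneousComponent (d + i) (SqTotal k (homogeneousComponent d f))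

/-- The space of hit polynomials: finite sums of `Sq^i (f_i)` with `i > 0`. -/
noncomputable def hitSubmodule (k : ℕ) :
    Submodule (ZMod 2) (MvPolynomial (Fin k) (ZMod 2)) :=
  Submodule.span (ZMod 2) {g | ∃ i f, 0 < i ∧ g = SqOp k i f}

/-- A polynomial is hit if it is a finite sum of `Sq^i (f_i)` with `i > 0`. -/
def IsHit (k : ℕ) (f : MvPolynomial (Fin k) (ZMod 2)) : Prop := f ∈ hitSubmodule k

/-- `(QP_k)_n`: the space of homogeneous polynomials of degree `n` modulo hit polynomials. -/
abbrev QP (k n : ℕ) :=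
  ↥(homogeneousSubmodule (Fin k) (ZMod 2) n) ⧸
    ((hitSubmodule k).comap (homogeneousSubmodule (Fin k) (ZMod 2) n).subtype)

/-- `ω_{i+1}(x)` for the monomial with exponent vector `a`: the number of variables whose
exponent has `i`-th binary digit equal to `1`. -/
def wvec (k : ℕ) (a : Fin k →₀ ℕ) (i : ℕ) : ℕ :=
  (Finset.univ.filter fun j : Fin k => Nat.testBit (a j) i).card

/-- Left lexicographic strict order on weight vectors. -/
def wlt (u v : ℕ → ℕ) : Prop := ∃ i, (∀ j, j < i → u j = v j) ∧ u i < v i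

/-- Left lexicographic (non-strict) order on weight vectors. -/
def wle (u v : ℕ → ℕ) : Prop := u = v ∨ wlt u v

/-- Left lexicographic order on the exponent vectors themselves, and the order `x < y`
on monomials of the same degree: either `ω(x) < ω(y)` lexicographically, or
`ω(x) = ω(y)` and `(ν_1(x), …, ν_k(x))` precedes `(ν_1(y), …, ν_k(y))`
lexicographically. -/
def monLT (k : ℕ) (a b : Fin k →₀ ℕ) : Prop :=
  wlt (wvec k a) (wvec k b) ∨
    ((∀ i, wvec k a i = wvec k b i) ∧ ∃ j : Fin k, (∀ i, i < j → a i = b i) ∧ a j < b j)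

/-- A monomial (given by its exponent vector `a`) is inadmissible: there are monomials
`y_1, …, y_t` of the same degree with `y_j < x` such that `x - (y_1 + … + y_t)` is hit. -/
def Inadmissible (k : ℕ) (a : Fin k →₀ ℕ) : Prop :=
  ∃ (t : ℕ) (y : Fin t → (Fin k →₀ ℕ)),
    (∀ j, (∑ i : Fin k, y j i) = ∑ i : Fin k, a i) ∧
    (∀ j, monLT k (y j) a) ∧
    IsHit k (MvPolynomial.monomial a (1 : ZMod 2) +
      ∑ j, MvPolynomial.monomial (y j) (1 : ZMod 2))

/-- A monomial is admissible if it is not inadmissible. -/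
def Admissible (k : ℕ) (a : Fin k →₀ ℕ) : Prop := ¬ Inadmissible k a

section Components

variable {σ R : Type*} [CommSemiring R]

theorem homogeneousComponent_add_mul {u : MvPolynomial σ R} {e : ℕ} (hu : u.IsHomogeneous e)
    (n : ℕ) (h : MvPolynomial σ R) :
    homogeneousComponent (e + n) (u * h) = u * homogeneousComponent n h := by
  conv_lhs => rw [← sum_homogeneousComponent h]
  rw [Finset.mul_sum, map_sum]
  have key : ∀ i ∈ Finset.range (h.totalDegree + 1),
      homogeneousComponent (e + n) (u * homogeneousComponent i h) =
        if n = i then u * homogeneousComponent i h else 0 := fun i _ => by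
    rw [homogeneousComponent_of_mem (hu.mul (homogeneousComponent_isHomogeneous i h))]
    simp
  rw [Finset.sum_congr rfl key, Finset.sum_ite_eq]
  split_ifs with hn
  · rfl
  · rw [homogeneousComponent_eq_zero _ _ (by simpa using hn), mul_zero]

theorem homogeneousComponent_mul_eq_zero {u : MvPolynomial σ R} {e m : ℕ}
    (hu : u.IsHomogeneous e) (hm : m < e) (h : MvPolynomial σ R) :
    homogeneousComponent m (u * h) = 0 := by
  conv_lhs => rw [← sum_homogeneousComponent h]
  rw [Finset.mul_sum, map_sum]
  refine Finset.sum_eq_zero fun i _ => ?_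
  rw [homogeneousComponent_of_mem (hu.mul (homogeneousComponent_isHomogeneous i h)),
    if_neg (by omega)]

end Components

section Hits

variable {k : ℕ}

theorem SqOp_of_isHomogeneous {f : MvPolynomial (Fin k) (ZMod 2)} {d : ℕ}
    (hf : f.IsHomogeneous d) (i : ℕ) :
    SqOp k i f = homogeneousComponent (d + i) (SqTotal k f) := by
  by_cases h0 : f = 0
  · simp [SqOp, h0]
  have hd := hf.totalDegree h0
  unfold SqOp
  rw [Finset.sum_eq_single d, homogeneousComponent_eq_self hf]
  · intro b _ hb
    rw [homogeneousComponent_of_mem hf, if_neg hb, map_zero, map_zero]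
  · intro h
    simp [hd] at h

theorem isHit_homogeneousComponent_SqTotal {f : MvPolynomial (Fin k) (ZMod 2)} {d i : ℕ}
    (hf : f.IsHomogeneous d) (hi : 0 < i) :
    IsHit k (homogeneousComponent (d + i) (SqTotal k f)) :=
  Submodule.subset_span ⟨i, f, hi, (SqOp_of_isHomogeneous hf i).symm⟩

/-- An additive predicate holds for all hit polynomials as soon as it holds for the Steenrod
squares of homogeneous polynomials. -/
theorem IsHit.induction {p : MvPolynomial (Fin k) (ZMod 2) → Prop} (zero : p 0)
    (add : ∀ f g, p f → p g → p (f + g))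
    (sq : ∀ (f : MvPolynomial (Fin k) (ZMod 2)) (d i : ℕ), f.IsHomogeneous d → 0 < i →
      p (homogeneousComponent (d + i) (SqTotal k f)))
    {h : MvPolynomial (Fin k) (ZMod 2)} (hh : IsHit k h) : p h := by
  refine Submodule.span_induction ?_ zero (fun f g _ _ => add f g) ?_ hh
  · rintro _ ⟨i, f, hi, rfl⟩
    exact Finset.sum_induction _ p add zero fun d _ =>
      sq _ d i (homogeneousComponent_isHomogeneous d f) hi
  · intro c f _ hf
    obtain rfl | rfl : c = 0 ∨ c = 1 := by revert c; decide
    · rwa [zero_smul]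
    · rwa [one_smul]

theorem SqTotal_X (j : Fin k) : SqTotal k (X j) = X j + X j ^ 2 := by
  simp [SqTotal]

theorem IsHit.X_mul_sq {h : MvPolynomial (Fin k) (ZMod 2)} (hh : IsHit k h) (p : Fin k) :
    IsHit k (X p * h ^ 2) := by
  refine IsHit.induction (p := fun h => IsHit k (X p * h ^ 2)) ?_ ?_ ?_ hh
  · rw [zero_pow two_ne_zero, mul_zero]
    exact Submodule.zero_mem _
  · intro f g hf hg
    rw [CharTwo.add_sq, mul_add]
    exact Submodule.add_mem _ hf hg
  · intro g d i hg hi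
    have hX : (X p : MvPolynomial (Fin k) (ZMod 2)).IsHomogeneous 1 := isHomogeneous_X _ p
    have hit := isHit_homogeneousComponent_SqTotal (i := 2 * i) (hX.mul (hg.pow 2)) (by omega)
    convert hit using 1
    rw [map_mul, map_pow, SqTotal_X]
    set G := SqTotal k g
    have hsq : G ^ 2 =
        ∑ n ∈ Finset.range (G.totalDegree + 1), homogeneousComponent n G ^ 2 := by
      conv_lhs => rw [← sum_homogeneousComponent G]
      exact CharTwo.sum_sq _ _
    rw [hsq, Finset.mul_sum, map_sum]
    have key : ∀ n ∈ Finset.range (G.totalDegree + 1),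
        homogeneousComponent (1 + d * 2 + 2 * i)
          ((X p + X p ^ 2) * homogeneousComponent n G ^ 2) =
        if d + i = n then X p * homogeneousComponent n G ^ 2 else 0 := fun n _ => by
      have hn := (homogeneousComponent_isHomogeneous n G).pow 2
      rw [add_mul, map_add, homogeneousComponent_of_mem (hX.mul hn),
        homogeneousComponent_of_mem ((hX.pow 2).mul hn),
        if_neg (show ¬ 1 + d * 2 + 2 * i = 1 * 2 + n * 2 by omega), add_zero]
      exact if_congr (by omega) rfl rfl
    rw [Finset.sum_congr rfl key, Finset.sum_ite_eq]
    split_ifs with hn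
    · rfl
    · rw [homogeneousComponent_eq_zero _ _ (by simpa using hn)]
      simp

/-- The derivation `∑ x_j² ∂/∂x_j`, which agrees with `Sq^1`. -/
noncomputable def sqOne (k : ℕ) :
    Derivation (ZMod 2) (MvPolynomial (Fin k) (ZMod 2)) (MvPolynomial (Fin k) (ZMod 2)) :=
  mkDerivation (ZMod 2) fun j => X j ^ 2

theorem sqOne_X (j : Fin k) : sqOne k (X j) = X j ^ 2 := mkDerivation_X _ _ _

theorem homogeneousComponent_SqTotal_monomial (n : ℕ) (a : Fin k →₀ ℕ) (ha : a.degree = n) :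
    (∀ m < n, homogeneousComponent m (SqTotal k (monomial a 1)) = 0) ∧
    homogeneousComponent n (SqTotal k (monomial a 1)) = monomial a 1 ∧
    homogeneousComponent (n + 1) (SqTotal k (monomial a 1)) = sqOne k (monomial a 1) := by
  induction n generalizing a with
  | zero =>
    obtain rfl : a = 0 := (Finsupp.degree_eq_zero_iff a).mp ha
    have h1 : (1 : MvPolynomial (Fin k) (ZMod 2)).IsHomogeneous 0 := isHomogeneous_one _ _
    refine ⟨by simp, ?_, ?_⟩
    · simp [homogeneousComponent_eq_self h1]
    · simp [homogeneousComponent_of_mem h1]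
  | succ n ih =>
    obtain ⟨j, hj⟩ : ∃ j, a j ≠ 0 := by
      by_contra! h
      obtain rfl : a = 0 := Finsupp.ext h
      simp at ha
    set b := a - Finsupp.single j 1 with hb
    have hab : a = Finsupp.single j 1 + b := by
      rw [hb, add_tsub_cancel_of_le]
      simpa [Finsupp.single_le_iff, Nat.one_le_iff_ne_zero] using hj
    have hbn : b.degree = n := by
      rw [hab, map_add, Finsupp.degree_single] at ha
      omega
    obtain ⟨h1, h2, h3⟩ := ih b hbn
    have hmon : (monomial a 1 : MvPolynomial (Fin k) (ZMod 2)) = X j * monomial b 1 := by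
      rw [hab, X, monomial_mul, one_mul]
    have hX : (X j : MvPolynomial (Fin k) (ZMod 2)).IsHomogeneous 1 := isHomogeneous_X _ j
    have hX2 : (X j ^ 2 : MvPolynomial (Fin k) (ZMod 2)).IsHomogeneous 2 := hX.pow 2
    rw [hmon, map_mul, SqTotal_X, add_mul]
    set G := SqTotal k (monomial b 1)
    have lin : ∀ m, homogeneousComponent (m + 1) (X j * G) = X j * homogeneousComponent m G :=
      fun m => by rw [add_comm, homogeneousComponent_add_mul hX]
    have quad : ∀ m,
        homogeneousComponent (m + 2) (X j ^ 2 * G) = X j ^ 2 * homogeneousComponent m G :=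
      fun m => by rw [add_comm, homogeneousComponent_add_mul hX2]
    have quad_low : ∀ m, m < n + 2 → homogeneousComponent m (X j ^ 2 * G) = 0 := by
      intro m hm
      obtain hm2 | ⟨m, rfl⟩ : m < 2 ∨ ∃ l, m = l + 2 :=
        (lt_or_ge m 2).imp_right fun h => ⟨m - 2, by omega⟩
      · exact homogeneousComponent_mul_eq_zero hX2 hm2 G
      · rw [quad, h1 m (by omega), mul_zero]
    refine ⟨fun m hm => ?_, ?_, ?_⟩
    · rw [map_add, quad_low m (by omega), add_zero]
      cases m with
      | zero => exact homogeneousComponent_mul_eq_zero hX one_pos G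
      | succ m => rw [lin, h1 m (by omega), mul_zero]
    · rw [map_add, lin, quad_low _ (by omega), h2, add_zero]
    · rw [map_add, lin, quad, h2, h3, Derivation.leibniz, sqOne_X, smul_eq_mul, smul_eq_mul]
      ring

theorem isHit_sqOne_monomial (a : Fin k →₀ ℕ) : IsHit k (sqOne k (monomial a 1)) := by
  rw [← (homogeneousComponent_SqTotal_monomial _ a rfl).2.2]
  exact isHit_homogeneousComponent_SqTotal (isHomogeneous_monomial 1 rfl) one_pos

end Hits

section Functional

variable {k : ℕ}

/-- Sets the variables in `T` equal to a single variable and the others equal to zero. -/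
noncomputable def collapse (T : Finset (Fin k)) :
    MvPolynomial (Fin k) (ZMod 2) →ₐ[ZMod 2] Polynomial (ZMod 2) :=
  aeval fun j => if j ∈ T then Polynomial.X else 0

theorem collapse_monomial (T : Finset (Fin k)) (a : Fin k →₀ ℕ) (c : ZMod 2) :
    collapse T (monomial a c) =
      if a.support ⊆ T then Polynomial.monomial a.degree c else 0 := by
  rw [collapse, aeval_monomial, Finsupp.prod]
  split_ifs with h
  · rw [Finset.prod_congr rfl fun j hj => by rw [if_pos (h hj)], Finset.prod_pow_eq_pow_sum,
      ← Finsupp.degree_apply, ← Polynomial.C_mul_X_pow_eq_monomial]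
    rfl
  · obtain ⟨j, hj, hjT⟩ := Finset.not_subset.mp h
    rw [Finset.prod_eq_zero hj, mul_zero]
    rw [if_neg hjT, zero_pow (Finsupp.mem_support_iff.mp hj)]

theorem collapse_homogeneousComponent (T : Finset (Fin k)) (n : ℕ)
    (f : MvPolynomial (Fin k) (ZMod 2)) :
    collapse T (homogeneousComponent n f) =
      Polynomial.monomial n ((collapse T f).coeff n) := by
  induction f using MvPolynomial.induction_on' with
  | add p q hp hq => simp [hp, hq]
  | monomial a c =>
    rw [homogeneousComponent_of_mem (isHomogeneous_monomial c rfl), collapse_monomial]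
    split_ifs with h1 h2 h2
    · subst h1
      simp [collapse_monomial, h2]
    · simp [collapse_monomial, h2]
    · simp [Polynomial.coeff_monomial, Ne.symm h1]
    · simp

theorem collapse_SqTotal (T : Finset (Fin k)) (f : MvPolynomial (Fin k) (ZMod 2)) :
    collapse T (SqTotal k f) =
      Polynomial.aeval (Polynomial.X + Polynomial.X ^ 2) (collapse T f) := by
  have : (collapse T).comp (SqTotal k) =
      (Polynomial.aeval (Polynomial.X + Polynomial.X ^ 2)).comp (collapse T) := by
    refine MvPolynomial.algHom_ext fun j => ?_
    by_cases h : j ∈ T <;> simp [SqTotal_X, collapse, h]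
  exact DFunLike.congr_fun this f

theorem even_choose_of_add_eq_two_pow_sub_one (s d i : ℕ) (hi : 0 < i)
    (h : d + i + 1 = 2 ^ s) : Even (d.choose i) := by
  induction s generalizing d i with
  | zero => omega
  | succ s ih =>
    have lucas : d.choose i ≡ (d % 2).choose (i % 2) * (d / 2).choose (i / 2) [MOD 2] :=
      Choose.choose_modEq_choose_mod_mul_choose_div_nat
    rw [Nat.even_iff, lucas, ← Nat.even_iff]
    rw [pow_succ] at h
    rcases Nat.mod_two_eq_zero_or_one i with h0 | h1
    · exact (ih (d / 2) (i / 2) (by omega) (by omega)).mul_left _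
    · have hd : d % 2 = 0 := by omega
      simp [h1, hd]

theorem coeff_collapse_of_isHit (s : ℕ) (T : Finset (Fin k))
    {h : MvPolynomial (Fin k) (ZMod 2)} (hh : IsHit k h) :
    (collapse T h).coeff (2 ^ s - 1) = 0 := by
  refine IsHit.induction (p := fun h => (collapse T h).coeff (2 ^ s - 1) = 0) ?_ ?_ ?_ hh
  · simp
  · intro f g hf hg
    simp [hf, hg]
  · intro f d i hf hi
    rw [collapse_homogeneousComponent, Polynomial.coeff_monomial]
    split_ifs with hdi
    · rw [collapse_SqTotal, ← homogeneousComponent_eq_self hf, collapse_homogeneousComponent,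
        Polynomial.aeval_monomial]
      have hfac : (Polynomial.X + Polynomial.X ^ 2 : Polynomial (ZMod 2)) ^ d =
          Polynomial.X ^ d * (1 + Polynomial.X) ^ d := by
        rw [← mul_pow]
        ring
      have heven := even_choose_of_add_eq_two_pow_sub_one s d i hi
        (by have := Nat.one_le_two_pow (n := s); omega)
      rw [hfac, Polynomial.algebraMap_eq, Polynomial.coeff_C_mul, add_comm d i,
        Polynomial.coeff_X_pow_mul, Polynomial.coeff_one_add_X_pow,
        (ZMod.natCast_eq_zero_iff_even).mpr heven, mul_zero]
    · rfl

/-- The number of monomials of degree `2 ^ s - 1` with support `S` is even in a hit polynomial. -/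
theorem sum_card_support_eq_zero_of_isHit {ι : Type*} (s : ℕ) (S : Finset (Fin k))
    (I : Finset ι) (y : ι → Fin k →₀ ℕ) (hy : ∀ j ∈ I, (y j).degree = 2 ^ s - 1)
    (hh : IsHit k (∑ j ∈ I, monomial (y j) 1)) :
    ∑ j ∈ I, (if (y j).support = S then (1 : ZMod 2) else 0) = 0 := by
  have h0 : ∑ T ∈ S.powerset,
      (collapse T (∑ j ∈ I, monomial (y j) 1)).coeff (2 ^ s - 1) = 0 :=
    Finset.sum_eq_zero fun T _ => coeff_collapse_of_isHit s T hh
  refine Eq.trans ?_ h0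
  simp_rw [map_sum, Polynomial.finsetSum_coeff]
  rw [Finset.sum_comm]
  refine Finset.sum_congr rfl fun j hj => ?_
  have : ∀ T ∈ S.powerset, (collapse T (monomial (y j) 1)).coeff (2 ^ s - 1) =
      if (y j).support ⊆ T then 1 else 0 := fun T _ => by
    rw [collapse_monomial]
    split_ifs <;> simp [hy j hj]
  rw [Finset.sum_congr rfl this, Finset.sum_boole]
  have hIcc : {T ∈ S.powerset | (y j).support ⊆ T} = Finset.Icc (y j).support S := by
    ext T
    simp [and_comm]
  rw [hIcc]
  by_cases hsub : (y j).support ⊆ S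
  · rw [Finset.card_Icc_finset hsub]
    split_ifs with heq
    · simp [heq]
    · have := Finset.card_lt_card (hsub.ssubset_of_ne heq)
      rw [Nat.cast_pow, Nat.cast_ofNat, show (2 : ZMod 2) = 0 from rfl, zero_pow (by omega)]
  · rw [if_neg fun h => hsub h.le, Finset.Icc_eq_empty hsub]
    simp

end Functional

section Lists

variable {k : ℕ}

/-- The exponent vector of `∏ x_{l_i}^{2^i}`. -/
noncomputable def binaryExponent : List (Fin k) → (Fin k →₀ ℕ)
  | [] => 0
  | p :: l => Finsupp.single p 1 + 2 • binaryExponent l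

/-- The monomial `∏ x_{l_i}^{2^i}`. -/
noncomputable def binaryMonomial (l : List (Fin k)) : MvPolynomial (Fin k) (ZMod 2) :=
  monomial (binaryExponent l) 1

theorem binaryMonomial_cons (p : Fin k) (l : List (Fin k)) :
    binaryMonomial (p :: l) = X p * binaryMonomial l ^ 2 := by
  rw [binaryMonomial, binaryMonomial, binaryExponent, X, monomial_pow, monomial_mul, one_pow,
    one_mul]

/-- Congruence of the monomials of two lists modulo hit polynomials. -/
def HitEquiv (l l' : List (Fin k)) : Prop := IsHit k (binaryMonomial l + binaryMonomial l')

theorem HitEquiv.refl (l : List (Fin k)) : HitEquiv l l := by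
  rw [HitEquiv, CharTwo.add_self_eq_zero]
  exact Submodule.zero_mem _

theorem HitEquiv.symm {l l' : List (Fin k)} (h : HitEquiv l l') : HitEquiv l' l := by
  rwa [HitEquiv, add_comm]

theorem HitEquiv.trans {l₁ l₂ l₃ : List (Fin k)} (h : HitEquiv l₁ l₂) (h' : HitEquiv l₂ l₃) :
    HitEquiv l₁ l₃ := by
  have := Submodule.add_mem _ h h'
  rwa [add_assoc, CharTwo.add_cancel_left] at this

theorem HitEquiv.cons (p : Fin k) {l l' : List (Fin k)} (h : HitEquiv l l') :
    HitEquiv (p :: l) (p :: l') := by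
  rw [HitEquiv, binaryMonomial_cons, binaryMonomial_cons, ← mul_add, ← CharTwo.add_sq]
  exact h.X_mul_sq p

theorem isHit_mul_sq (p q : Fin k) (b : Fin k →₀ ℕ) :
    IsHit k ((X p ^ 2 * X q + X p * X q ^ 2) * monomial b 1 ^ 2) := by
  have hmon : X p * X q * monomial b (1 : ZMod 2) ^ 2 =
      monomial (Finsupp.single p 1 + Finsupp.single q 1 + 2 • b) 1 := by
    simp [X, monomial_pow, monomial_mul]
  have hsq : sqOne k (monomial b 1 ^ 2) = 0 := by
    rw [Derivation.leibniz_pow, two_nsmul, CharTwo.add_self_eq_zero]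
  convert isHit_sqOne_monomial (Finsupp.single p 1 + Finsupp.single q 1 + 2 • b) using 1
  rw [← hmon, Derivation.leibniz, hsq, Derivation.leibniz, sqOne_X, sqOne_X]
  simp only [smul_eq_mul]
  ring

theorem HitEquiv.swap (p q : Fin k) (l : List (Fin k)) :
    HitEquiv (p :: q :: l) (q :: p :: l) := by
  have : monomial (2 • binaryExponent l) (1 : ZMod 2) = binaryMonomial l ^ 2 := by
    simp [binaryMonomial, monomial_pow]
  have h := isHit_mul_sq p q (2 • binaryExponent l)
  rw [this] at h
  rw [HitEquiv]
  convert h using 1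
  simp only [binaryMonomial_cons]
  ring

theorem HitEquiv.flip (p q : Fin k) (l : List (Fin k)) :
    HitEquiv (p :: p :: q :: l) (q :: q :: p :: l) := by
  have : monomial (Finsupp.single p 1 + Finsupp.single q 1 + 4 • binaryExponent l)
      (1 : ZMod 2) = X p * X q * binaryMonomial l ^ 4 := by
    simp [binaryMonomial, X, monomial_pow, monomial_mul]
  have h := isHit_mul_sq p q
    (Finsupp.single p 1 + Finsupp.single q 1 + 4 • binaryExponent l)
  rw [this] at h
  rw [HitEquiv]
  convert h using 1
  simp only [binaryMonomial_cons]
  ring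

theorem HitEquiv.of_perm {l l' : List (Fin k)} (h : l.Perm l') : HitEquiv l l' := by
  induction h with
  | nil => exact .refl _
  | cons p _ ih => exact ih.cons p
  | swap p q l => exact .swap q p l
  | trans _ _ ih ih' => exact ih.trans ih'

theorem HitEquiv.exchange {p q : Fin k} {l : List (Fin k)} (hp : p ∈ l) (hq : q ∈ l) :
    HitEquiv (p :: l) (q :: l) := by
  by_cases hpq : p = q
  · rw [hpq]
    exact .refl _
  have hl : l.Perm (p :: q :: (l.erase p).erase q) :=
    (List.perm_cons_erase hp).trans
      ((List.perm_cons_erase ((List.mem_erase_of_ne (Ne.symm hpq)).mpr hq)).cons p)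
  exact (HitEquiv.of_perm (hl.cons p)).trans ((HitEquiv.flip p q _).trans
    (.of_perm (((List.Perm.swap p q _).trans hl.symm).cons q)))

theorem HitEquiv.append_of_subset {l : List (Fin k)} (A B : List (Fin k))
    (h : A.length = B.length) (hA : A ⊆ l) (hB : B ⊆ l) : HitEquiv (A ++ l) (B ++ l) := by
  induction A generalizing B with
  | nil =>
    obtain rfl := List.eq_nil_of_length_eq_zero h.symm
    exact .refl _
  | cons p A ih =>
    obtain _ | ⟨q, B⟩ := B
    · simp at h
    · rw [List.cons_subset] at hA hB
      exact (HitEquiv.exchange (List.mem_append_right A hA.1)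
        (List.mem_append_right A hB.1)).trans ((ih B (by simpa using h) hA.2 hB.2).cons q)

theorem HitEquiv.of_toFinset_eq {l l' : List (Fin k)} (hlen : l.length = l'.length)
    (hset : l.toFinset = l'.toFinset) : HitEquiv l l' := by
  have split : ∀ t : List (Fin k), ∃ A, A ⊆ t.toFinset.toList ∧
      t.Perm (A ++ t.toFinset.toList) := fun t => by
    have hsub : t.toFinset.toList.Subperm t :=
      (Finset.nodup_toList _).subperm fun x hx => by simpa using hx
    obtain ⟨u, hu, hut⟩ := hsub
    obtain ⟨A, hA⟩ := hut.exists_perm_append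
    exact ⟨A, fun x hx => by simpa using hA.mem_iff.mpr (List.mem_append_right u hx),
      hA.trans (List.perm_append_comm.trans (hu.append_left A))⟩
  obtain ⟨A, hA, hAl⟩ := split l
  obtain ⟨B, hB, hBl⟩ := split l'
  rw [← hset] at hB hBl
  refine (HitEquiv.of_perm hAl).trans ((HitEquiv.append_of_subset A B ?_ hA hB).trans
    (HitEquiv.of_perm hBl.symm))
  have h₁ := hAl.length_eq
  have h₂ := hBl.length_eq
  rw [List.length_append] at h₁ h₂
  omega

theorem support_binaryExponent (l : List (Fin k)) :
    (binaryExponent l).support = l.toFinset := by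
  induction l with
  | nil => simp [binaryExponent]
  | cons p l ih =>
    ext j
    have := Finset.ext_iff.mp ih j
    simp only [Finsupp.mem_support_iff, List.mem_toFinset] at this
    simp only [binaryExponent, Finsupp.mem_support_iff, List.mem_toFinset, List.mem_cons, ← this,
      Finsupp.add_apply, Finsupp.smul_apply, Finsupp.single_apply, eq_comm (a := j)]
    split_ifs with h <;> simp [h]

theorem degree_binaryExponent (l : List (Fin k)) :
    (binaryExponent l).degree = 2 ^ l.length - 1 := by
  induction l with
  | nil => simp [binaryExponent]
  | cons p l ih =>
    have := Nat.one_le_two_pow (n := l.length)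
    rw [binaryExponent, map_add, map_nsmul, ih, Finsupp.degree_single, List.length_cons, pow_succ,
      smul_eq_mul]
    omega

theorem binaryExponent_append (l l' : List (Fin k)) :
    binaryExponent (l ++ l') = binaryExponent l + 2 ^ l.length • binaryExponent l' := by
  induction l with
  | nil => simp [binaryExponent]
  | cons p l ih =>
    rw [List.cons_append, binaryExponent, binaryExponent, ih, List.length_cons, pow_succ',
      nsmul_add, mul_nsmul', add_assoc]

theorem binaryExponent_replicate (n : ℕ) (p : Fin k) :
    binaryExponent (List.replicate n p) = Finsupp.single p (2 ^ n - 1) := by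
  induction n with
  | zero => simp [binaryExponent]
  | succ n ih =>
    have := Nat.one_le_two_pow (n := n)
    rw [List.replicate_succ, binaryExponent, ih, Finsupp.smul_single, ← Finsupp.single_add,
      pow_succ, smul_eq_mul]
    congr 1
    omega

theorem binaryExponent_ofFn {m : ℕ} (e : Fin m → Fin k) :
    binaryExponent (List.ofFn e) = ∑ j : Fin m, Finsupp.single (e j) (2 ^ (j : ℕ)) := by
  induction m with
  | zero => simp [binaryExponent]
  | succ m ih =>
    rw [List.ofFn_succ, binaryExponent, ih, Fin.sum_univ_succ, Finset.smul_sum]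
    simp [pow_succ, mul_comm]

end Lists

section Weights

variable {k : ℕ}

/-- The weight vector `(1, …, 1, 0, …)` with `s` ones. -/
def onesWeight (s : ℕ) : ℕ → ℕ := fun i => if i < s then 1 else 0

theorem onesWeight_succ_succ (s i : ℕ) : onesWeight (s + 1) (i + 1) = onesWeight s i := by
  simp [onesWeight]

theorem onesWeight_le_one (s i : ℕ) : onesWeight s i ≤ 1 := by
  unfold onesWeight
  split_ifs <;> omega

/-- The exponent vector obtained by dropping the lowest binary digits. -/
noncomputable def halfExponent (a : Fin k →₀ ℕ) : Fin k →₀ ℕ :=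
  a.mapRange (· / 2) (Nat.zero_div 2)

theorem wvec_halfExponent (a : Fin k →₀ ℕ) (i : ℕ) :
    wvec k (halfExponent a) i = wvec k a (i + 1) := by
  refine congrArg Finset.card (Finset.filter_congr fun j _ => ?_)
  rw [halfExponent, Finsupp.mapRange_apply, Nat.testBit_succ]

theorem sum_eq_wvec_zero_add (a : Fin k →₀ ℕ) :
    ∑ j, a j = wvec k a 0 + 2 * ∑ j, halfExponent a j := by
  rw [wvec, Finset.card_filter, Finset.mul_sum, ← Finset.sum_add_distrib]
  refine Finset.sum_congr rfl fun j _ => ?_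
  have : halfExponent a j = a j / 2 := by simp [halfExponent]
  rw [this, Nat.testBit_zero]
  split_ifs with h <;> simp only [decide_eq_true_eq] at h <;> omega

theorem wvec_binaryExponent (l : List (Fin k)) :
    wvec k (binaryExponent l) = onesWeight l.length := by
  induction l with
  | nil =>
    funext i
    simp [binaryExponent, wvec, onesWeight]
  | cons p l ih =>
    have hval : ∀ j, binaryExponent (p :: l) j =
        (if p = j then 1 else 0) + 2 * binaryExponent l j := fun j => by
      simp [binaryExponent, Finsupp.single_apply]
    have hhalf : halfExponent (binaryExponent (p :: l)) = binaryExponent l := by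
      ext j
      rw [halfExponent, Finsupp.mapRange_apply, hval]
      split_ifs <;> omega
    funext i
    cases i with
    | zero =>
      refine Finset.card_eq_one.mpr ⟨p, ?_⟩
      ext j
      simp only [hval, Nat.testBit_zero, Finset.mem_filter, Finset.mem_univ, true_and,
        Finset.mem_singleton, decide_eq_true_eq, eq_comm (a := j)]
      split_ifs with h <;> simp [h]
    | succ i => rw [← wvec_halfExponent, hhalf, ih, List.length_cons, onesWeight_succ_succ]

theorem exists_binaryExponent_eq (s : ℕ) (a : Fin k →₀ ℕ) (ha : wvec k a = onesWeight s) :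
    ∃ l : List (Fin k), l.length = s ∧ binaryExponent l = a := by
  induction s generalizing a with
  | zero =>
    refine ⟨[], rfl, ?_⟩
    ext j
    refine (Nat.eq_of_testBit_eq fun i => ?_ : (0 : ℕ) = a j)
    have hi : wvec k a i = 0 := by simp [ha, onesWeight]
    rw [wvec, Finset.card_eq_zero, Finset.filter_eq_empty_iff] at hi
    simpa using hi (Finset.mem_univ j)
  | succ s ih =>
    obtain ⟨l, hl, hla⟩ := ih (halfExponent a) <| funext fun i => by
      rw [wvec_halfExponent, ha, onesWeight_succ_succ]
    have h0 : wvec k a 0 = 1 := by simp [ha, onesWeight]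
    obtain ⟨p, hp⟩ := Finset.card_eq_one.mp h0
    refine ⟨p :: l, by simp [hl], ?_⟩
    ext j
    have hj := Finset.ext_iff.mp hp j
    simp only [Nat.testBit_zero, Finset.mem_filter, Finset.mem_univ, true_and,
      Finset.mem_singleton, decide_eq_true_eq, eq_comm (a := j)] at hj
    rw [binaryExponent, hla]
    simp only [halfExponent, Finsupp.add_apply, Finsupp.smul_apply, Finsupp.mapRange_apply,
      Finsupp.single_apply, smul_eq_mul, ← hj]
    split_ifs <;> omega

theorem not_wlt_onesWeight (s : ℕ) (a : Fin k →₀ ℕ) (hdeg : ∑ j, a j = 2 ^ s - 1) :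
    ¬ wlt (wvec k a) (onesWeight s) := by
  induction s generalizing a with
  | zero =>
    rintro ⟨i, -, hi⟩
    simp [onesWeight] at hi
  | succ s ih =>
    rintro ⟨i, hbelow, hi⟩
    have hsum := sum_eq_wvec_zero_add a
    have hpow := Nat.one_le_two_pow (n := s)
    rw [hdeg, pow_succ] at hsum
    cases i with
    | zero =>
      simp only [onesWeight, Nat.zero_lt_succ, if_true] at hi
      omega
    | succ i =>
      have h0 : wvec k a 0 = 1 := by simp [hbelow 0 i.succ_pos, onesWeight]
      refine ih (halfExponent a) (by omega) ⟨i, fun j hj => ?_, ?_⟩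
      · rw [wvec_halfExponent, hbelow (j + 1) (by omega), onesWeight_succ_succ]
      · rwa [wvec_halfExponent, ← onesWeight_succ_succ]

end Weights

section Canonical

variable {k : ℕ}

/-- The exponent vector of `x_{e 0} x_{e 1}^2 ⋯ x_{e m}^{2^s - 2^m}`. -/
noncomputable def canonicalExponent (s m : ℕ) (e : Fin (m + 1) → Fin k) : Fin k →₀ ℕ :=
  ∑ j : Fin (m + 1), Finsupp.single (e j)
    (if (j : ℕ) = m then 2 ^ s - 2 ^ m else 2 ^ (j : ℕ))

theorem canonicalExponent_apply {s m : ℕ} {e : Fin (m + 1) → Fin k}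
    (he : Function.Injective e) (j : Fin (m + 1)) :
    canonicalExponent s m e (e j) = if (j : ℕ) = m then 2 ^ s - 2 ^ m else 2 ^ (j : ℕ) := by
  rw [canonicalExponent, Finsupp.finsetSum_apply, Finset.sum_eq_single j]
  · simp
  · intro i _ hij
    rw [Finsupp.single_eq_of_ne (he.ne hij.symm)]
  · simp

/-- A list of length `s` whose monomial is the canonical one. -/
def canonicalList (s m : ℕ) (e : Fin (m + 1) → Fin k) : List (Fin k) :=
  List.ofFn (fun j : Fin m => e j.castSucc) ++ List.replicate (s - m) (e (Fin.last m))

theorem binaryExponent_canonicalList {s m : ℕ} (hm : m < s) (e : Fin (m + 1) → Fin k) :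
    binaryExponent (canonicalList s m e) = canonicalExponent s m e := by
  rw [canonicalList, binaryExponent_append, binaryExponent_ofFn, binaryExponent_replicate,
    canonicalExponent, Fin.sum_univ_castSucc, List.length_ofFn, Finsupp.smul_single]
  congr 1
  · refine Finset.sum_congr rfl fun j _ => ?_
    rw [Fin.val_castSucc, if_neg j.isLt.ne]
  · rw [Fin.val_last, if_pos rfl, smul_eq_mul, Nat.mul_sub, ← pow_add, mul_one,
      Nat.add_sub_cancel' hm.le]

theorem length_canonicalList {s m : ℕ} (hm : m < s) (e : Fin (m + 1) → Fin k) :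
    (canonicalList s m e).length = s := by
  simp [canonicalList, hm.le]

theorem mem_canonicalList {s m : ℕ} (hm : m < s) (e : Fin (m + 1) → Fin k) (x : Fin k) :
    x ∈ canonicalList s m e ↔ ∃ j, e j = x := by
  rw [Fin.exists_fin_succ', canonicalList, List.mem_append, List.mem_ofFn, List.mem_replicate]
  refine or_congr Iff.rfl ?_
  rw [eq_comm, and_iff_right (by omega)]

theorem mem_support_canonicalExponent {s m : ℕ} (hm : m < s) (e : Fin (m + 1) → Fin k)
    (x : Fin k) : x ∈ (canonicalExponent s m e).support ↔ ∃ j, e j = x := by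
  rw [← binaryExponent_canonicalList hm, support_binaryExponent, List.mem_toFinset,
    mem_canonicalList hm]

theorem wvec_canonicalExponent {s m : ℕ} (hm : m < s) (e : Fin (m + 1) → Fin k) :
    wvec k (canonicalExponent s m e) = onesWeight s := by
  rw [← binaryExponent_canonicalList hm, wvec_binaryExponent, length_canonicalList hm]

theorem sum_canonicalExponent {s m : ℕ} (hm : m < s) (e : Fin (m + 1) → Fin k) :
    ∑ j, canonicalExponent s m e j = 2 ^ s - 1 := by
  rw [← binaryExponent_canonicalList hm, ← Finsupp.degree_eq_sum, degree_binaryExponent,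
    length_canonicalList hm]

/-- The canonical exponent vector is lexicographically minimal among those with the same support
and weight vector `(1, …, 1)`. -/
theorem canonicalExponent_minimal {s m : ℕ} (hm : m < s) {e : Fin (m + 1) → Fin k}
    (he : StrictMono e) {y : Fin k →₀ ℕ} (hwy : wvec k y = onesWeight s)
    (hdeg : ∑ j, y j = 2 ^ s - 1) (hsupp : y.support = (canonicalExponent s m e).support)
    {p : Fin k} (hbelow : ∀ i < p, y i = canonicalExponent s m e i) :
    canonicalExponent s m e p ≤ y p := by
  by_contra! hp
  obtain ⟨j, rfl⟩ := (mem_support_canonicalExponent hm e p).mp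
    (Finsupp.mem_support_iff.mpr (by omega))
  have hy0 : y (e j) ≠ 0 := by
    rw [← Finsupp.mem_support_iff, hsupp, mem_support_canonicalExponent hm]
    exact ⟨j, rfl⟩
  by_cases hj : (j : ℕ) = m
  · have hle : ∀ i ∈ Finset.univ, y i ≤ canonicalExponent s m e i := fun i _ => by
      rcases lt_trichotomy i (e j) with h | rfl | h
      · exact (hbelow i h).le
      · exact hp.le
      · suffices i ∉ y.support by simp [Finsupp.notMem_support_iff.mp this]
        rw [hsupp, mem_support_canonicalExponent hm]
        rintro ⟨j', rfl⟩
        have := he.lt_iff_lt.mp h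
        omega
    have := Finset.sum_lt_sum hle ⟨e j, Finset.mem_univ _, hp⟩
    rw [hdeg, sum_canonicalExponent hm] at this
    exact this.false
  · rw [canonicalExponent_apply he.injective, if_neg hj] at hp
    obtain ⟨i, hi⟩ := Nat.exists_testBit_of_ne_zero hy0
    have hij : i < (j : ℕ) :=
      (Nat.pow_lt_pow_iff_right one_lt_two).mp ((Nat.ge_two_pow_of_testBit hi).trans_lt hp)
    have hlt : e ⟨i, by omega⟩ < e j := he (by simpa [Fin.lt_def] using hij)
    have hyi : y (e ⟨i, by omega⟩) = 2 ^ i := by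
      rw [hbelow _ hlt, canonicalExponent_apply he.injective, if_neg (by simp; omega)]
    have htwo : 1 < wvec k y i := Finset.one_lt_card.mpr
      ⟨e ⟨i, by omega⟩, by simp [hyi], e j, by simp [hi], hlt.ne⟩
    have := onesWeight_le_one s i
    rw [hwy] at htwo
    omega

theorem inadmissible_of_ne_canonicalExponent {s m : ℕ} (hm : m < s) {e : Fin (m + 1) → Fin k}
    (he : StrictMono e) {a : Fin k →₀ ℕ} (hwa : wvec k a = onesWeight s)
    (hdeg : ∑ j, a j = 2 ^ s - 1) (hsupp : a.support = (canonicalExponent s m e).support)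
    (hne : a ≠ canonicalExponent s m e) : Inadmissible k a := by
  obtain ⟨p, hp, hmin⟩ : ∃ p, a p ≠ canonicalExponent s m e p ∧
      ∀ i < p, a i = canonicalExponent s m e i := by
    obtain ⟨q, hq⟩ := DFunLike.ne_iff.mp hne
    obtain ⟨p, hp, hmin⟩ := WellFounded.has_min (wellFounded_lt (α := Fin k))
      {p | a p ≠ canonicalExponent s m e p} ⟨q, hq⟩
    exact ⟨p, hp, fun i hi => not_not.mp fun h => hmin i h hi⟩
  have hlt : canonicalExponent s m e p < a p :=
    lt_of_le_of_ne (canonicalExponent_minimal hm he hwa hdeg hsupp hmin) hp.symm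
  obtain ⟨l, hl, rfl⟩ := exists_binaryExponent_eq s a hwa
  refine ⟨1, fun _ => canonicalExponent s m e, fun _ => ?_, fun _ => Or.inr ⟨fun i => ?_, ?_⟩, ?_⟩
  · rw [sum_canonicalExponent hm, hdeg]
  · rw [wvec_canonicalExponent hm, hwa]
  · exact ⟨p, fun i hi => (hmin i hi).symm, hlt⟩
  · rw [Fin.sum_univ_one, ← binaryExponent_canonicalList hm]
    refine HitEquiv.of_toFinset_eq (hl.trans (length_canonicalList hm e).symm) ?_
    rw [← support_binaryExponent, ← support_binaryExponent, hsupp,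
      binaryExponent_canonicalList hm]

theorem admissible_canonicalExponent {s m : ℕ} (hm : m < s) {e : Fin (m + 1) → Fin k}
    (he : StrictMono e) : Admissible k (canonicalExponent s m e) := by
  rintro ⟨t, y, hdeg, hlt, hit⟩
  set c := canonicalExponent s m e
  have hc := sum_canonicalExponent hm e
  have hsum := sum_card_support_eq_zero_of_isHit s c.support Finset.univ
    (fun o : Option (Fin t) => o.elim c y)
    (fun o _ => by
      rw [Finsupp.degree_eq_sum]
      cases o with
      | none => exact hc
      | some j => exact (hdeg j).trans hc)
    (by rwa [Fintype.sum_option])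
  rw [Fintype.sum_option] at hsum
  by_cases hex : ∃ j, (y j).support = c.support
  · obtain ⟨j, hj⟩ := hex
    have hyj := (hdeg j).trans hc
    have hwc := wvec_canonicalExponent hm e
    rcases hlt j with hw | ⟨hw, p, hbelow, hp⟩
    · rw [hwc] at hw
      exact not_wlt_onesWeight s (y j) hyj hw
    · exact hp.not_ge
        (canonicalExponent_minimal hm he ((funext hw).trans hwc) hyj hj hbelow)
  · push Not at hex
    simp [hex] at hsum

end Canonical

/-- Proposition 4.1: a monomial `x` of degree `2^s - 1` in `P_k` with
`ω(x) ≤ (1^{(s)})` in the left lexicographic order is admissible if and only if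
`x = x_{i_1} x_{i_2}^2 ⋯ x_{i_{m-1}}^{2^{m-2}} x_{i_m}^{2^s - 2^{m-1}}` for some
`1 ≤ m ≤ min{s, k}` and `1 ≤ i_1 < … < i_m ≤ k`. -/
theorem stmt19 (k s : ℕ) (hk : 1 ≤ k) (hs : 1 ≤ s) (a : Fin k →₀ ℕ)
    (hdeg : ∑ j, a j = 2 ^ s - 1)
    (hw : wle (wvec k a) fun i => if i < s then 1 else 0) :
    Admissible k a ↔
      ∃ (m : ℕ), 1 ≤ m ∧ m ≤ min s k ∧
        ∃ e : Fin m → Fin k, StrictMono e ∧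
          a = ∑ j : Fin m,
              Finsupp.single (e j)
                (if (j : ℕ) = m - 1 then 2 ^ s - 2 ^ (m - 1) else 2 ^ (j : ℕ)) := by
  have hwa : wvec k a = onesWeight s := hw.resolve_right (not_wlt_onesWeight s a hdeg)
  constructor
  · intro hadm
    obtain ⟨l, hl, hla⟩ := exists_binaryExponent_eq s a hwa
    have hcard : a.support.card ≤ s := by
      rw [← hla, support_binaryExponent, ← hl]
      exact List.toFinset_card_le l
    have hpos : a.support.card ≠ 0 := fun h => by
      obtain rfl : a = 0 := by simpa using h
      have := Nat.one_lt_two_pow (n := s) (by omega)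
      simp at hdeg
      omega
    obtain ⟨m, hm⟩ := Nat.exists_eq_succ_of_ne_zero hpos
    refine ⟨m + 1, by omega, le_min (by omega) ?_, a.support.orderEmbOfFin hm,
      (a.support.orderEmbOfFin hm).strictMono, ?_⟩
    · rw [← Nat.succ_eq_add_one, ← hm]
      exact card_finset_fin_le _
    · by_contra hne
      refine hadm (inadmissible_of_ne_canonicalExponent (m := m) (by omega)
        (a.support.orderEmbOfFin hm).strictMono hwa hdeg ?_ hne)
      ext x
      rw [mem_support_canonicalExponent (by omega), ← Finset.mem_coe,
        ← Finset.range_orderEmbOfFin a.support hm, Set.mem_range]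
  · rintro ⟨m, h1, hms, e, he, rfl⟩
    obtain ⟨m, rfl⟩ := Nat.exists_eq_add_of_le' h1
    exact admissible_canonicalExponent (by omega) he
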